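/- Fix integers A, B with Δ := 4A³ + 27B² ≠ 0, so that y² = x³ + Ax + B defines an elliptic curve over ℚ, and for each odd prime p not dividing 6Δ set a_p := p − #{(x, y) ∈ 𝔽_p × 𝔽_p : y² = x³ + Ax + B}. Let F(x) = max(0, 1 − |x|), and for a real x > e define β_p(x) := (a_p · log p / p) · F(log p / log x). For a nonzero integer D set f(x,D) := 2 log|D| + (log x)/2 and R(x,D) := 2 ∑_{p odd prime, p ∤ 6Δ} β_p(x) · (D/p), where (D/p) is the Legendre symbol. Let W : ℝ → ℝ be nonnegative, three times continuously differentiable, and compactly supported on (1/2, 1). Fix integers k ≥ 1, i ≥ 0 and an ODD integer r ≥ 1, and set X_k := x^{k/2} (log x)^{2k+2}. Then there exist a constant C > 0 and a threshold x₀ (both depending only on A, B, W, k, i, r) such that for all x ≥ x₀: | ∑_{D ∈ ℤ, D ≠ 0} f(x,D)^i · R(x,D)^r · W(D/X_k) | ≤ C · x^{3r} · (log x)^{r+i} / X_k². -/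

import Mathlib

open Filter

/-- `a_p = p - #{(x,y) ∈ 𝔽_p × 𝔽_p : y² = x³ + Ax + B}`. -/
noncomputable def apEC (A B : ℤ) (p : ℕ) : ℤ :=
  (p : ℤ) - Nat.card {xy : ZMod p × ZMod p //
      xy.2 ^ 2 = xy.1 ^ 3 + (A : ZMod p) * xy.1 + (B : ZMod p)}

/-- `β_p(x) = (a_p log p / p) F(log p / log x)`, with `F` the triangle function. -/
noncomputable def betaEC (A B : ℤ) (x : ℝ) (p : ℕ) : ℝ :=
  (apEC A B p : ℝ) * Real.log p / p * max 0 (1 - |Real.log p / Real.log x|)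

/-- `R(x,D) = 2 ∑_{p odd prime, p ∤ 6Δ} β_p(x) (D/p)`, with `(D/p)` the Legendre
symbol (realised via the Jacobi symbol, which agrees with it for odd primes). -/
noncomputable def REC (A B : ℤ) (x : ℝ) (D : ℤ) : ℝ :=
  2 * ∑' p : ℕ,
        if p.Prime ∧ Odd p ∧ ¬ ((p : ℤ) ∣ 6 * (4 * A ^ 3 + 27 * B ^ 2)) then
          betaEC A B x p * (jacobiSym D p : ℝ)
        else 0

/-- `X_k = x^{k/2} (log x)^{2k+2}`. -/
noncomputable def XkEC (x : ℝ) (k : ℕ) : ℝ :=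
  x ^ ((k : ℝ) / 2) * Real.log x ^ (2 * k + 2)

section Helpers
open Polynomial

section Stepanov

/-- Core nonvanishing step. -/
theorem stp_core {p n : ℕ} [Fact p.Prime] (hp : p = 2 * n + 3) (f : (ZMod p)[X])
    (hdeg : f.natDegree = 3) (h0 : f.eval 0 ≠ 0) (r s u v : (ZMod p)[X])
    (hr : r ∈ degreeLT (ZMod p) n) (hs : s ∈ degreeLT (ZMod p) n)
    (h : (r + X ^ p * u) + (s + X ^ p * v) * f ^ (n + 1) = 0) : r = 0 ∧ s = 0 := by
  have hf0 : f ≠ 0 := by rintro rfl; simp at hdeg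
  have h1 : f * (r + X ^ p * u) ^ 2 = (s + X ^ p * v) ^ 2 * f ^ p := by
    have : r + X ^ p * u = - ((s + X ^ p * v) * f ^ (n + 1)) := by linear_combination h
    rw [this]
    have h2 : f ^ p = f * (f ^ (n+1)) ^ 2 := (congrArg (f ^ ·) hp).trans (by ring)
    rw [h2]; ring
  obtain ⟨w, hw⟩ : X ∣ f - C (f.eval 0) := by
    rw [X_dvd_iff, coeff_zero_eq_eval_zero]; simp
  have h3 : f ^ p = C (f.eval 0 ^ p) + X ^ p * w ^ p := by
    rw [← mul_pow, ← hw, sub_pow_char, C_pow]; ring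
  set c := f.eval 0 ^ p with hc
  have hc0 : c ≠ 0 := pow_ne_zero _ h0
  have h4 : X ^ p ∣ f * r ^ 2 - C c * s ^ 2 := by
    rw [h3] at h1
    refine ⟨- f * (2 * r * u + X ^ p * u ^ 2) + (2 * s * v + X ^ p * v ^ 2) * C c
      + (s + X ^ p * v) ^ 2 * w ^ p, ?_⟩
    linear_combination h1
  have hrd : r = 0 ∨ r.natDegree < n := by
    by_cases hr0 : r = 0
    · exact Or.inl hr0
    · right; rw [mem_degreeLT] at hr; exact (natDegree_lt_iff_degree_lt hr0).2 hr
  have hsd : s = 0 ∨ s.natDegree < n := by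
    by_cases hr0 : s = 0
    · exact Or.inl hr0
    · right; rw [mem_degreeLT] at hs; exact (natDegree_lt_iff_degree_lt hr0).2 hs
  have hA : (f * r ^ 2).natDegree < p := by
    rcases hrd with h | h
    · simp [h]; omega
    · refine lt_of_le_of_lt natDegree_mul_le ?_
      rw [natDegree_pow, hdeg]; omega
  have hB : (C c * s ^ 2).natDegree < p := by
    rcases hsd with h | h
    · simp [h]; omega
    · refine lt_of_le_of_lt natDegree_mul_le ?_
      rw [natDegree_pow, natDegree_C]; omega
  have h5 : f * r ^ 2 - C c * s ^ 2 = 0 := by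
    by_contra hne
    have := natDegree_le_of_dvd h4 hne
    rw [natDegree_X_pow] at this
    have := natDegree_sub_le (f * r ^ 2) (C c * s ^ 2)
    omega
  have h6 : f * r ^ 2 = C c * s ^ 2 := sub_eq_zero.1 h5
  have hCc : C c ≠ 0 := C_ne_zero.2 hc0
  by_cases hr0 : r = 0
  · refine ⟨hr0, ?_⟩
    rw [hr0] at h6
    simp only [ne_eq, OfNat.ofNat_ne_zero, not_false_eq_true, zero_pow, mul_zero] at h6
    have := mul_eq_zero.1 h6.symm
    simpa [hCc] using this
  · exfalso
    have hs0 : s ≠ 0 := by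
      rintro rfl
      simp [hf0, hr0] at h6
    have := congrArg natDegree h6
    rw [natDegree_mul hf0 (pow_ne_zero _ hr0), natDegree_C_mul hc0, natDegree_pow, natDegree_pow,
      hdeg] at this
    omega

theorem stp_nonvanish {p n : ℕ} [Fact p.Prime] (hp : p = 2 * n + 3) (f : (ZMod p)[X])
    (hdeg : f.natDegree = 3) (h0 : f.eval 0 ≠ 0) (J : ℕ) (r s : Fin J → (ZMod p)[X])
    (hr : ∀ j, r j ∈ degreeLT (ZMod p) n) (hs : ∀ j, s j ∈ degreeLT (ZMod p) n)
    (h : ∑ j, (r j + s j * f ^ (n + 1)) * X ^ (p * (j : ℕ)) = 0) :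
    ∀ j, r j = 0 ∧ s j = 0 := by
  induction J with
  | zero => intro j; exact j.elim0
  | succ J ih =>
    rw [Fin.sum_univ_succ] at h
    have e : ∑ i : Fin J, (r i.succ + s i.succ * f ^ (n + 1)) * X ^ (p * (i.succ : ℕ))
        = X ^ p * ∑ i : Fin J, (r i.succ + s i.succ * f ^ (n + 1)) * X ^ (p * (i : ℕ)) := by
      rw [Finset.mul_sum]
      refine Finset.sum_congr rfl fun i _ => ?_
      rw [Fin.val_succ, mul_add, pow_add]; ring
    rw [e] at h
    have e2 : ∑ i : Fin J, (r i.succ + s i.succ * f ^ (n + 1)) * X ^ (p * (i : ℕ))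
       = (∑ i : Fin J, r i.succ * X ^ (p * (i : ℕ))) +
         (∑ i : Fin J, s i.succ * X ^ (p * (i : ℕ))) * f ^ (n+1) := by
      rw [Finset.sum_mul, ← Finset.sum_add_distrib]
      refine Finset.sum_congr rfl fun i _ => ?_
      ring
    have hz := stp_core hp f hdeg h0 (r 0) (s 0) (∑ i : Fin J, r i.succ * X ^ (p * (i : ℕ)))
      (∑ i : Fin J, s i.succ * X ^ (p * (i : ℕ))) (hr 0) (hs 0) (by
        rw [e2] at h
        simp only [Fin.val_zero, mul_zero, pow_zero, mul_one] at h
        linear_combination h)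
    rw [hz.1, hz.2] at h
    simp only [zero_mul, add_zero, zero_add] at h
    have h' := (mul_eq_zero.1 h).resolve_left (pow_ne_zero _ X_ne_zero)
    have := ih (fun i => r i.succ) (fun i => s i.succ) (fun i => hr _) (fun i => hs _) h'
    intro j
    refine Fin.cases hz this j

/-- Operators describing the iterated derivatives of `f ^ M * s`. -/
noncomputable def stpU {F : Type*} [Field F] (f : F[X]) (M : F) : ℕ → (F[X] →ₗ[F] F[X])
  | 0 => LinearMap.id
  | k + 1 => (LinearMap.mulLeft F (C (M - k) * derivative f)) ∘ₗ stpU f M k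
      + (LinearMap.mulLeft F f) ∘ₗ (Polynomial.derivative ∘ₗ stpU f M k)

theorem stpU_succ {F : Type*} [Field F] (f : F[X]) (M : F) (k : ℕ) (s : F[X]) :
    stpU f M (k+1) s = C (M - k) * derivative f * stpU f M k s + f * derivative (stpU f M k s) := by
  simp [stpU, mul_assoc]

theorem stpU_deriv {p : ℕ} [Fact p.Prime] (f s : (ZMod p)[X]) (M j k : ℕ) (hk : k ≤ M) :
    derivative^[k] (f ^ M * s * X ^ (p * j)) = f ^ (M - k) * stpU f (M : ZMod p) k s * X ^ (p * j) := by
  induction k with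
  | zero => simp [stpU]
  | succ k ih =>
    rw [Function.iterate_succ_apply', ih (by omega), stpU_succ]
    obtain ⟨d, rfl⟩ : ∃ d, M = k + 1 + d := ⟨M - (k+1), by omega⟩
    have e1 : k + 1 + d - k = d + 1 := by omega
    have e2 : k + 1 + d - (k+1) = d := by omega
    rw [e1, e2]
    have hX : derivative (X ^ (p * j) : (ZMod p)[X]) = 0 := by
      rw [derivative_X_pow]; simp
    rw [derivative_mul, hX, derivative_mul, derivative_pow]
    have : ((k + 1 + d : ℕ) : ZMod p) - k = ((d + 1 : ℕ) : ZMod p) := by push_cast; ring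
    rw [this]
    simp only [Nat.add_sub_cancel, map_natCast]
    ring

theorem stpU_deg {F : Type*} [Field F] (f : F[X]) (hf : f.natDegree = 3) (M : F) (k n : ℕ) (s : F[X])
    (hs : s ∈ degreeLT F n) : stpU f M k s ∈ degreeLT F (n + 2 * k) := by
  induction k with
  | zero => simpa [stpU] using hs
  | succ k ih =>
    rw [stpU_succ]
    set t := stpU f M k s
    by_cases ht : t = 0
    · rw [ht]; simp
    rw [mem_degreeLT] at ih
    have h1 : t.natDegree < n + 2 * k := (natDegree_lt_iff_degree_lt ht).2 ih
    have h2 : (derivative f).natDegree ≤ 2 := by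
      have := natDegree_derivative_le f; omega
    rw [mem_degreeLT]
    refine lt_of_le_of_lt degree_le_natDegree ?_
    norm_cast
    have h3 : (C (M - k) * derivative f * t).natDegree ≤ 2 + t.natDegree := by
      refine natDegree_mul_le.trans ?_
      have := natDegree_C_mul_le (M - k) (derivative f)
      omega
    have h4 : (f * derivative t).natDegree ≤ 2 + t.natDegree := by
      by_cases h0 : t.natDegree = 0
      · rw [derivative_of_natDegree_zero h0]; simp
      · refine natDegree_mul_le.trans ?_
        have := natDegree_derivative_le t
        omega
    have := natDegree_add_le (C (M - k) * derivative f * t) (f * derivative t)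
    omega

end Stepanov

theorem stp_count {p n m : ℕ} [Fact p.Prime] (hp : p = 2 * n + 3) (f : (ZMod p)[X])
    (hdeg : f.natDegree = 3) (h0 : f.eval 0 ≠ 0) (hm7 : 7 ≤ m) (hmn : m ^ 2 ≤ n)
    (a : ZMod p) (S : Finset (ZMod p)) (hS : ∀ x ∈ S, f.eval x ^ (n + 1) = a) :
    S.card * (2 * m) ≤ 6 * m + p * (m + 7) := by
  set l := 2 * m with hl
  set J := m + 6 with hJ
  let V := (Fin J → degreeLT (ZMod p) n) × (Fin J → degreeLT (ZMod p) n)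
  let T : Fin l → V → (ZMod p)[X] := fun k v =>
    ∑ j : Fin J, (stpU f (l : ZMod p) k (v.1 j : (ZMod p)[X])
      + C a * stpU f ((l + (n + 1) : ℕ) : ZMod p) k (v.2 j : (ZMod p)[X])) * X ^ (j : ℕ)
  let Φ : V →ₗ[ZMod p] (Fin l × Fin (n + 2 * l + J) → ZMod p) :=
    { toFun := fun v q => (T q.1 v).coeff q.2
      map_add' := by
        intro v w; ext q
        simp only [T, Pi.add_apply]
        rw [← coeff_add, ← Finset.sum_add_distrib]
        congr 1
        refine Finset.sum_congr rfl fun j _ => ?_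
        have e1 : (((v + w).1 j : degreeLT (ZMod p) n) : (ZMod p)[X]) = v.1 j + w.1 j := rfl
        have e2 : (((v + w).2 j : degreeLT (ZMod p) n) : (ZMod p)[X]) = v.2 j + w.2 j := rfl
        rw [e1, e2, map_add, map_add]
        ring
      map_smul' := by
        intro c v; ext q
        simp only [T, Pi.smul_apply, RingHom.id_apply]
        rw [← coeff_smul, Finset.smul_sum]
        congr 1
        refine Finset.sum_congr rfl fun j _ => ?_
        have e1 : (((c • v).1 j : degreeLT (ZMod p) n) : (ZMod p)[X]) = c • (v.1 j : (ZMod p)[X]) := rfl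
        have e2 : (((c • v).2 j : degreeLT (ZMod p) n) : (ZMod p)[X]) = c • (v.2 j : (ZMod p)[X]) := rfl
        rw [e1, e2, map_smul, map_smul]
        simp only [smul_eq_C_mul]
        ring }
  have : Module.Finite (ZMod p) (degreeLT (ZMod p) n) :=
    Module.Finite.equiv (degreeLTEquiv (ZMod p) n).symm
  have hdimV : Module.finrank (ZMod p) V = J * n + J * n := by
    simp only [V]
    rw [Module.finrank_prod, Module.finrank_pi_fintype]
    simp [(degreeLTEquiv (ZMod p) n).finrank_eq]
  have hdimW : Module.finrank (ZMod p) (Fin l × Fin (n + 2 * l + J) → ZMod p)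
      = l * (n + 2 * l + J) := by
    rw [Module.finrank_pi]; simp
  have hlt : l * (n + 2 * l + J) < J * n + J * n := by
    rw [hl, hJ]; nlinarith
  have hker : LinearMap.ker Φ ≠ ⊥ := LinearMap.ker_ne_bot_of_finrank_lt (by rw [hdimV, hdimW]; exact hlt)
  obtain ⟨v, hv, hv0⟩ := (Submodule.ne_bot_iff _).1 hker
  have hT : ∀ k : Fin l, T k v = 0 := by
    intro k
    have hmem : T k v ∈ degreeLT (ZMod p) (n + 2 * l + J) := by
      refine Submodule.sum_mem _ fun j _ => ?_
      have h1 := stpU_deg f hdeg (l : ZMod p) k n (v.1 j) (v.1 j).2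
      have h2 := stpU_deg f hdeg ((l + (n + 1) : ℕ) : ZMod p) k n (v.2 j) (v.2 j).2
      have h3 : stpU f (l : ZMod p) k (v.1 j : (ZMod p)[X])
        + C a * stpU f ((l + (n + 1) : ℕ) : ZMod p) k (v.2 j : (ZMod p)[X])
          ∈ degreeLT (ZMod p) (n + 2 * k) := by
        refine Submodule.add_mem _ h1 ?_
        rw [← smul_eq_C_mul]
        exact Submodule.smul_mem _ _ h2
      set q := stpU f (l : ZMod p) k (v.1 j : (ZMod p)[X])
        + C a * stpU f ((l + (n + 1) : ℕ) : ZMod p) k (v.2 j : (ZMod p)[X])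
      by_cases hq : q = 0
      · rw [hq]; simp
      rw [mem_degreeLT] at h3 ⊢
      have h4 := (natDegree_lt_iff_degree_lt hq).2 h3
      refine lt_of_le_of_lt degree_le_natDegree ?_
      norm_cast
      rw [natDegree_mul_X_pow _ hq]
      have := j.2
      have := k.2
      omega
    ext i
    by_cases hi : i < n + 2 * l + J
    · have := congrFun (LinearMap.mem_ker.1 hv) (k, ⟨i, hi⟩)
      simpa [Φ] using this
    · rw [coeff_zero]
      apply coeff_eq_zero_of_degree_lt
      rw [mem_degreeLT] at hmem
      refine lt_of_lt_of_le hmem ?_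
      norm_cast; omega
  set R : (ZMod p)[X] := ∑ j : Fin J,
    (f ^ l * (v.1 j : (ZMod p)[X]) * X ^ (p * (j : ℕ))
      + f ^ (l + (n + 1)) * (v.2 j : (ZMod p)[X]) * X ^ (p * (j : ℕ))) with hR
  have hf0 : f ≠ 0 := by rintro rfl; simp at hdeg
  have hR0 : R ≠ 0 := by
    intro hR0
    apply hv0
    have : f ^ l * ∑ j : Fin J, ((v.1 j : (ZMod p)[X]) + (v.2 j : (ZMod p)[X]) * f ^ (n + 1))
        * X ^ (p * (j : ℕ)) = 0 := by
      rw [← hR0, hR, Finset.mul_sum]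
      refine Finset.sum_congr rfl fun j _ => ?_
      ring
    have h1 := (mul_eq_zero.1 this).resolve_left (pow_ne_zero _ hf0)
    have h2 := stp_nonvanish hp f hdeg h0 J (fun j => v.1 j) (fun j => v.2 j)
      (fun j => (v.1 j).2) (fun j => (v.2 j).2) h1
    refine Prod.ext ?_ ?_
    · funext j; exact Subtype.ext (h2 j).1
    · funext j; exact Subtype.ext (h2 j).2
  have hderiv : ∀ k, k < l → ∀ x ∈ S, (derivative^[k] R).eval x = 0 := by
    intro k hk x hx
    have h1 : derivative^[k] R = ∑ j : Fin J,
      (f ^ (l - k) * stpU f (l : ZMod p) k (v.1 j) * X ^ (p * (j : ℕ))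
       + f ^ (l + (n + 1) - k) * stpU f ((l + (n + 1) : ℕ) : ZMod p) k (v.2 j) * X ^ (p * (j : ℕ))) := by
      rw [hR, iterate_derivative_sum]
      refine Finset.sum_congr rfl fun j _ => ?_
      rw [iterate_map_add, stpU_deriv _ _ _ _ _ hk.le, stpU_deriv _ _ _ _ _ (by omega)]
    have h2 := congrArg (eval x) (hT ⟨k, hk⟩)
    simp only [T, eval_finsetSum, eval_zero, eval_mul, eval_add, eval_pow, eval_X, eval_C] at h2
    rw [h1]
    simp only [eval_finsetSum, eval_mul, eval_add, eval_pow, eval_X]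
    have e : l + (n + 1) - k = (l - k) + (n + 1) := by omega
    rw [← mul_zero (f.eval x ^ (l - k)), ← h2, Finset.mul_sum]
    refine Finset.sum_congr rfl fun j _ => ?_
    rw [e, pow_add, hS x hx, pow_mul, ZMod.pow_card]
    ring
  have hmn' : m ≤ n := by nlinarith
  have hmult : ∀ x ∈ S, l ≤ R.rootMultiplicity x := by
    intro x hx
    have := lt_rootMultiplicity_of_isRoot_iterate_derivative_of_mem_nonZeroDivisors' (n := l - 1)
      (t := x) hR0 (fun k hk => hderiv k (by omega) x hx) (by
        intro k hk hk0
        rw [mem_nonZeroDivisors_iff_ne_zero]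
        intro h
        rw [ZMod.natCast_eq_zero_iff] at h
        have := Nat.le_of_dvd (by omega) h
        omega)
    omega
  have hcard : S.card * l ≤ R.natDegree := by
    calc S.card * l = ∑ x ∈ S, l := by simp
      _ ≤ ∑ x ∈ S, R.roots.count x := Finset.sum_le_sum fun x hx => by
          rw [count_roots]; exact hmult x hx
      _ ≤ ∑ x ∈ S ∪ R.roots.toFinset, R.roots.count x :=
          Finset.sum_le_sum_of_subset Finset.subset_union_left
      _ = R.roots.card := Multiset.sum_count_eq_card (by
          intro x hx; simp only [Finset.mem_union, Multiset.mem_toFinset]; exact Or.inr hx)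
      _ ≤ R.natDegree := card_roots' R
  have hle : R.natDegree ≤ 6 * m + p * (m + 7) := by
    rw [hR]
    refine natDegree_sum_le_of_forall_le _ _ fun j _ => ?_
    have hj : p * (j : ℕ) + p ≤ p * J := by
      have := j.2
      calc p * (j : ℕ) + p = p * (j + 1) := by ring
        _ ≤ p * J := Nat.mul_le_mul_left _ this
    have hd : ∀ q : degreeLT (ZMod p) n, (q : (ZMod p)[X]).natDegree ≤ n := by
      intro q
      exact natDegree_le_of_degree_le (mem_degreeLT.1 q.2).le
    have hterm : ∀ (M : ℕ) (q : degreeLT (ZMod p) n), M ≤ l + (n + 1) →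
        (f ^ M * (q : (ZMod p)[X]) * X ^ (p * (j : ℕ))).natDegree ≤ 6 * m + p * (m + 7) := by
      intro M q hM
      refine natDegree_mul_le.trans ?_
      rw [natDegree_X_pow]
      have h1 := natDegree_mul_le (p := f ^ M) (q := (q : (ZMod p)[X]))
      rw [natDegree_pow, hdeg] at h1
      have h2 := hd q
      have h3 : p * (m + 7) = p * J + p := by rw [hJ]; ring
      omega
    refine (natDegree_add_le _ _).trans (max_le ?_ ?_)
    · exact hterm _ _ (by omega)
    · exact hterm _ _ (by omega)
  exact hcard.trans hle

/-- Half count bound for arbitrary cubics (by translation). -/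
theorem stp_count' {p n m : ℕ} [Fact p.Prime] (hp : p = 2 * n + 3) (f : (ZMod p)[X])
    (hdeg : f.natDegree = 3) (hm7 : 7 ≤ m) (hmn : m ^ 2 ≤ n)
    (a : ZMod p) (S : Finset (ZMod p)) (hS : ∀ x ∈ S, f.eval x ^ (n + 1) = a) :
    S.card * (2 * m) ≤ 6 * m + p * (m + 7) := by
  have hf0 : f ≠ 0 := by rintro rfl; simp at hdeg
  obtain ⟨t, ht⟩ : ∃ t, f.eval t ≠ 0 := by
    by_contra! h
    have h1 := card_le_degree_of_subset_roots (p := f) (Z := Finset.univ) (by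
      intro x _
      rw [mem_roots hf0]; exact h x)
    rw [Finset.card_univ, ZMod.card, hdeg] at h1
    nlinarith
  have hX : (X + C t : (ZMod p)[X]).natDegree = 1 := natDegree_X_add_C t
  have h := stp_count hp (f.comp (X + C t)) (by rw [natDegree_comp, hdeg, hX]) (by simpa using ht)
    hm7 hmn a (S.image (fun x => x - t)) (by
      intro x hx
      obtain ⟨y, hy, rfl⟩ := Finset.mem_image.1 hx
      simpa using hS y hy)
  rwa [Finset.card_image_of_injective _ (sub_left_injective)] at h

theorem apEC_eq (A B : ℤ) (p : ℕ) [Fact p.Prime] (hp2 : p ≠ 2) :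
    apEC A B p = - ∑ x : ZMod p, quadraticChar (ZMod p) (x ^ 3 + (A : ZMod p) * x + (B : ZMod p)) := by
  have hF : ringChar (ZMod p) ≠ 2 := by rw [ZMod.ringChar_zmod_n]; exact hp2
  unfold apEC
  have h1 : Nat.card {xy : ZMod p × ZMod p //
      xy.2 ^ 2 = xy.1 ^ 3 + (A : ZMod p) * xy.1 + (B : ZMod p)}
      = ∑ x : ZMod p, {y : ZMod p | y ^ 2 = x ^ 3 + (A : ZMod p) * x + (B : ZMod p)}.toFinset.card := by
    rw [Nat.card_eq_fintype_card, Fintype.card_subtype, Finset.card_filter, ← Finset.univ_product_univ,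
      Finset.sum_product]
    refine Finset.sum_congr rfl fun x _ => ?_
    rw [← Finset.card_filter]
    congr 1
    ext y; simp
  rw [h1]
  push_cast
  simp_rw [quadraticChar_card_sqrts hF]
  rw [Finset.sum_add_distrib]
  simp

theorem hasse_weak (A B : ℤ) (p : ℕ) (hp : p.Prime) (hp2 : p ≠ 2) :
    |(apEC A B p : ℝ)| ≤ 23 * Real.sqrt p := by
  have : Fact p.Prime := ⟨hp⟩
  have hF : ringChar (ZMod p) ≠ 2 := by rw [ZMod.ringChar_zmod_n]; exact hp2
  have hp3 : 3 ≤ p := by have := hp.two_le; omega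
  have hodd : p % 2 = 1 := by
    rcases hp.eq_two_or_odd with h | h
    · exact absurd h hp2
    · exact h
  obtain ⟨n, hn⟩ : ∃ n, p = 2 * n + 3 := ⟨(p - 3) / 2, by omega⟩
  set f : (ZMod p)[X] := X ^ 3 + C (A : ZMod p) * X + C (B : ZMod p) with hf
  have hdeg : f.natDegree = 3 := by rw [hf]; compute_degree!
  have hf0 : f ≠ 0 := by intro h; rw [h] at hdeg; simp at hdeg
  have hev : ∀ x, f.eval x = x ^ 3 + (A : ZMod p) * x + (B : ZMod p) := by
    intro x; simp [hf]
  set P := Finset.univ.filter (fun x : ZMod p => quadraticChar (ZMod p) (f.eval x) = 1) with hP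
  set M := Finset.univ.filter (fun x : ZMod p => quadraticChar (ZMod p) (f.eval x) = -1) with hM
  set Z := Finset.univ.filter (fun x : ZMod p => f.eval x = 0) with hZ
  have hZ3 : Z.card ≤ 3 := by
    rw [← hdeg]
    refine card_le_degree_of_subset_roots (by
      intro x hx
      rw [mem_roots hf0]
      have : x ∈ Z := hx
      simpa [hZ] using this)
  have key : ∀ x, (quadraticChar (ZMod p) (f.eval x) : ℤ)
      = (if quadraticChar (ZMod p) (f.eval x) = 1 then 1 else 0)
        - (if quadraticChar (ZMod p) (f.eval x) = -1 then 1 else 0) ∧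
      (1 : ℤ) = (if quadraticChar (ZMod p) (f.eval x) = 1 then 1 else 0)
        + (if quadraticChar (ZMod p) (f.eval x) = -1 then 1 else 0)
        + (if f.eval x = 0 then 1 else 0) := by
    intro x
    by_cases h0 : f.eval x = 0
    · simp [h0]
    · rcases quadraticChar_dichotomy h0 with h | h <;> simp [h, h0]
  have hap : apEC A B p = (M.card : ℤ) - P.card := by
    rw [apEC_eq A B p hp2, hP, hM, Finset.card_filter, Finset.card_filter]
    push_cast
    rw [← Finset.sum_sub_distrib, ← Finset.sum_neg_distrib]
    refine Finset.sum_congr rfl fun x _ => ?_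
    rw [← hev]
    have := (key x).1
    linarith
  have htot : (p : ℤ) = P.card + M.card + Z.card := by
    rw [hP, hM, hZ, Finset.card_filter, Finset.card_filter, Finset.card_filter]
    push_cast
    rw [← Finset.sum_add_distrib, ← Finset.sum_add_distrib]
    rw [← Finset.sum_congr rfl (fun x _ => (key x).2)]
    simp
  have hsq : Real.sqrt p * Real.sqrt p = p := Real.mul_self_sqrt (by positivity)
  have hs1 : 1 ≤ Real.sqrt p := by
    rw [Real.one_le_sqrt]; exact_mod_cast (by omega : 1 ≤ p)
  have hapR : (apEC A B p : ℝ) = M.card - P.card := by rw [hap]; push_cast; ring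
  have htotR : (p : ℝ) = P.card + M.card + Z.card := by exact_mod_cast htot
  have hZR : (Z.card : ℝ) ≤ 3 := by exact_mod_cast hZ3
  by_cases hsmall : n < 49
  · have h1 : |(apEC A B p : ℝ)| ≤ p := by
      rw [hapR, abs_le]
      have : (0:ℝ) ≤ P.card := Nat.cast_nonneg _
      have : (0:ℝ) ≤ M.card := Nat.cast_nonneg _
      have : (0:ℝ) ≤ Z.card := Nat.cast_nonneg _
      constructor <;> linarith
    have h2 : Real.sqrt p ≤ 23 := by
      rw [Real.sqrt_le_left (by norm_num)]
      have : (p : ℝ) ≤ 101 := by exact_mod_cast (by omega : p ≤ 101)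
      linarith
    nlinarith
  · set m := Nat.sqrt n with hm
    have hm7 : 7 ≤ m := by
      rw [hm, Nat.le_sqrt]; omega
    have hmn : m ^ 2 ≤ n := Nat.sqrt_le' n
    have hmn2 : n < (m + 1) ^ 2 := Nat.lt_succ_sqrt' n
    have hbound : ∀ (a : ZMod p) (S : Finset (ZMod p)), (∀ x ∈ S, f.eval x ^ (n + 1) = a) →
        2 * (S.card : ℝ) ≤ p + 20 * Real.sqrt p := by
      intro a S hS
      have h := stp_count' hn f hdeg hm7 hmn a S hS
      have h' : (S.card : ℝ) * (2 * m) ≤ 6 * m + p * (m + 7) := by exact_mod_cast h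
      have hmR : (7 : ℝ) ≤ m := by exact_mod_cast hm7
      have hpm : (p : ℝ) ≤ 4 * m ^ 2 := by
        have : p ≤ 4 * m ^ 2 := by nlinarith
        exact_mod_cast this
      have hsm : Real.sqrt p ≤ 2 * m := by
        rw [Real.sqrt_le_left (by positivity)]; nlinarith
      have h3 : (p : ℝ) ≤ 2 * m * Real.sqrt p := by nlinarith
      have h4 : (m : ℝ) * (2 * S.card) ≤ m * (p + 20 * Real.sqrt p) := by nlinarith
      exact le_of_mul_le_mul_left h4 (by linarith)
    have hexp : Fintype.card (ZMod p) / 2 = n + 1 := by rw [ZMod.card]; omega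
    have hPb := hbound 1 P (by
      intro x hx
      have hx' : quadraticChar (ZMod p) (f.eval x) = 1 := by simpa [hP] using hx
      rw [← hexp, ← quadraticChar_eq_pow_of_char_ne_two' hF, hx']; simp)
    have hMb := hbound (-1) M (by
      intro x hx
      have hx' : quadraticChar (ZMod p) (f.eval x) = -1 := by simpa [hM] using hx
      rw [← hexp, ← quadraticChar_eq_pow_of_char_ne_two' hF, hx']; simp)
    rw [hapR, abs_le]
    constructor <;> linarith

theorem gauss_bound (p : ℕ) [Fact p.Prime] (hp2 : p ≠ 2) (ψ : AddChar (ZMod p) ℂ) :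
    ‖∑ x : ZMod p, ((quadraticChar (ZMod p) x : ℤ) : ℂ) * ψ x‖ ≤ Real.sqrt p := by
  have hF : ringChar (ZMod p) ≠ 2 := by rw [ZMod.ringChar_zmod_n]; exact hp2
  by_cases hψ : ψ = 1
  · subst hψ
    have : ∑ x : ZMod p, ((quadraticChar (ZMod p) x : ℤ) : ℂ) * (1 : AddChar (ZMod p) ℂ) x = 0 := by
      simp only [AddChar.one_apply, mul_one]
      exact_mod_cast quadraticChar_sum_zero hF
    rw [this]; simp
  · set χ : MulChar (ZMod p) ℂ := (quadraticChar (ZMod p)).ringHomComp (Int.castRingHom ℂ) with hχ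
    have hq : χ.IsQuadratic := (quadraticChar_isQuadratic (ZMod p)).comp _
    have h1 : χ ≠ 1 := by
      obtain ⟨a, ha⟩ := quadraticChar_exists_neg_one' hF
      intro h
      have h2 := congrArg (fun c : MulChar (ZMod p) ℂ => c (a : ZMod p)) h
      simp [hχ, MulChar.ringHomComp_apply, ha] at h2
      norm_num at h2
    have h := gaussSum_sq h1 hq (AddChar.IsPrimitive.of_ne_one hψ)
    have h3 : ‖gaussSum χ ψ‖ ^ 2 = p := by
      rw [← norm_pow, h, norm_mul]
      have : ‖χ (-1)‖ = 1 := by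
        rcases hq (-1) with h | h | h
        · exfalso
          have : IsUnit (χ (-1)) := IsUnit.map χ (isUnit_one.neg)
          rw [h] at this; simp at this
        · rw [h]; simp
        · rw [h]; simp
      rw [this]; simp
    have h4 : ‖gaussSum χ ψ‖ = Real.sqrt p := by
      rw [← h3, Real.sqrt_sq (norm_nonneg _)]
    have h5 : gaussSum χ ψ = ∑ x : ZMod p, ((quadraticChar (ZMod p) x : ℤ) : ℂ) * ψ x := by
      simp [gaussSum, hχ, MulChar.ringHomComp_apply]
    rw [← h5, h4]

theorem addChar_map_sum {ι G : Type*} [AddCommGroup G] (s : Finset ι) (ψ : AddChar G ℂ) (g : ι → G) :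
    ψ (∑ i ∈ s, g i) = ∏ i ∈ s, ψ (g i) := by
  classical
  induction s using Finset.induction_on with
  | empty => simp
  | insert a s ha ih => rw [Finset.sum_insert ha, Finset.prod_insert ha, AddChar.map_add_eq_mul, ih]

theorem crt_sum {ι : Type*} [Fintype ι] [DecidableEq ι] (a : ι → ℕ) [∀ i, NeZero (a i)]
    [NeZero (∏ i, a i)]
    (hco : Pairwise (Function.onFun Nat.Coprime a)) (h : ∀ i, ZMod (a i) → ℂ)
    (ψ : AddChar (ZMod (∏ i, a i)) ℂ) :
    ∃ φ : ∀ i, AddChar (ZMod (a i)) ℂ, (ψ = 1 → ∀ i, φ i = 1) ∧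
      ∑ x : ZMod (∏ i, a i), (∏ i, h i (ZMod.prodEquivPi a hco x i)) * ψ x
        = ∏ i, ∑ y : ZMod (a i), h i y * φ i y := by
  let e := ZMod.prodEquivPi a hco
  let φ : ∀ i, AddChar (ZMod (a i)) ℂ := fun i =>
    ψ.compAddMonoidHom (e.symm.toAddEquiv.toAddMonoidHom.comp (AddMonoidHom.single (fun i => ZMod (a i)) i))
  have hφ : ∀ i y, φ i y = ψ (e.symm (Pi.single i y)) := by
    intro i y; rfl
  refine ⟨φ, ?_, ?_⟩
  · rintro h1 i
    ext y
    rw [hφ, h1]; simp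
  · rw [Finset.prod_univ_sum, Fintype.piFinset_univ, ← Equiv.sum_comp e.toEquiv]
    refine Finset.sum_congr rfl fun x _ => ?_
    rw [Finset.prod_mul_distrib]
    congr 1
    simp_rw [hφ]
    rw [← addChar_map_sum, ← map_sum]
    congr 1
    have := Finset.univ_sum_single (e x)
    change x = e.symm (∑ i, Pi.single i (e x i))
    rw [this]; simp

theorem norm_std_sub_one {N : ℕ} [NeZero N] (k : ZMod N) :
    4 * |(k.valMinAbs : ℝ)| / N ≤ ‖ZMod.stdAddChar k - 1‖ := by
  have hN : (0 : ℝ) < N := by exact_mod_cast Nat.pos_of_ne_zero (NeZero.ne N)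
  have h1 : ZMod.stdAddChar k = Complex.exp (Complex.I * ((2 * Real.pi * k.valMinAbs / N : ℝ) : ℂ)) := by
    conv_lhs => rw [← ZMod.coe_valMinAbs k]
    rw [ZMod.stdAddChar_coe]
    congr 1; push_cast; ring
  rw [h1, Complex.norm_exp_I_mul_ofReal_sub_one]
  have hk := ZMod.valMinAbs_mem_Ioc k
  have hk2 : |(k.valMinAbs : ℝ)| * 2 ≤ N := by
    have h3 : ((-N : ℤ) : ℝ) ≤ ((k.valMinAbs * 2 : ℤ) : ℝ) := by exact_mod_cast hk.1.le
    have h4 : ((k.valMinAbs * 2 : ℤ) : ℝ) ≤ N := by exact_mod_cast hk.2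
    push_cast at h3 h4
    rcases abs_cases (k.valMinAbs : ℝ) with ⟨h, _⟩ | ⟨h, _⟩ <;> rw [h] <;> linarith
  have e : 2 * Real.pi * k.valMinAbs / N / 2 = Real.pi * k.valMinAbs / N := by ring
  rw [e]
  have habs : |Real.pi * k.valMinAbs / N| = Real.pi * |(k.valMinAbs : ℝ)| / N := by
    rw [abs_div, abs_mul, abs_of_pos Real.pi_pos, abs_of_pos hN]
  have h5 := Real.mul_abs_le_abs_sin (x := Real.pi * k.valMinAbs / N) (by
    rw [habs, div_le_div_iff₀ hN (by norm_num)]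
    nlinarith [Real.pi_pos])
  rw [habs] at h5
  rw [norm_mul, Real.norm_eq_abs, Real.norm_eq_abs, abs_two]
  have h6 : 2 / Real.pi * (Real.pi * |(k.valMinAbs : ℝ)| / N) = 2 * |(k.valMinAbs : ℝ)| / N := by
    field_simp
  rw [h6] at h5
  calc _ = 2 * (2 * |(k.valMinAbs : ℝ)| / N) := by ring
    _ ≤ _ := by linarith

/-- The absolute constant. -/
noncomputable def kzeta : ℝ := ∑' n : ℤ, |1 / (n : ℝ) ^ 3|

theorem kzeta_summable : Summable (fun n : ℤ => |1 / (n : ℝ) ^ 3|) :=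
  (Real.summable_one_div_int_pow.2 (by norm_num)).abs

theorem kzeta_nonneg : 0 ≤ kzeta := tsum_nonneg fun _ => abs_nonneg _

theorem third_antideriv {N : ℕ} [NeZero N] (Φ : ZMod N → ℂ) (c : ℝ)
    (h0 : ∑ x, Φ x = 0) (hc : ∀ ψ : AddChar (ZMod N) ℂ, ‖∑ x, Φ x * ψ x‖ ≤ c) :
    ∃ T : ℤ → ℂ, (∀ n : ℤ, T (n + 3) - 3 * T (n + 2) + 3 * T (n + 1) - T n = Φ n) ∧
      ∀ n, ‖T n‖ ≤ kzeta * (c * N ^ 2) := by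
  have hN : (0 : ℝ) < N := by exact_mod_cast Nat.pos_of_ne_zero (NeZero.ne N)
  set G := ZMod.dft Φ with hG
  have hGc : ∀ k, ‖G k‖ ≤ c := by
    intro k
    have := hc ((ZMod.stdAddChar (N := N)).mulShift (-k))
    convert this using 2
    rw [hG, ZMod.dft_apply]
    refine Finset.sum_congr rfl fun x _ => ?_
    rw [AddChar.mulShift_apply, smul_eq_mul, mul_comm]
    congr 2; ring
  have hG0 : G 0 = 0 := by rw [hG, ZMod.dft_apply_zero, h0]
  have hcnn : 0 ≤ c := (norm_nonneg _).trans (hGc 0)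
  have hinv : ∀ n : ZMod N, Φ n = (N : ℂ)⁻¹ * ∑ k, ZMod.stdAddChar (k * n) * G k := by
    intro n
    have := ZMod.invDFT_apply G n
    rw [hG, LinearEquiv.symm_apply_apply] at this
    simpa [smul_eq_mul] using this
  let z : ZMod N → ℂ := fun k => ZMod.stdAddChar k
  have hz : ∀ k, k ≠ 0 → z k - 1 ≠ 0 := by
    intro k hk h
    apply hk
    apply ZMod.injective_stdAddChar
    rw [AddChar.map_zero_eq_one]
    exact sub_eq_zero.1 h
  let T : ℤ → ℂ := fun n => (N : ℂ)⁻¹ * ∑ k, ZMod.stdAddChar (k * (n : ZMod N)) * G k / (z k - 1) ^ 3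
  refine ⟨T, ?_, ?_⟩
  · intro n
    rw [hinv]
    simp only [T]
    have hh : ∀ a b c d : ℂ, (N : ℂ)⁻¹ * a - 3 * ((N : ℂ)⁻¹ * b) + 3 * ((N : ℂ)⁻¹ * c) - (N : ℂ)⁻¹ * d
        = (N : ℂ)⁻¹ * (a - 3 * b + 3 * c - d) := by intros; ring
    rw [hh]
    congr 1
    rw [Finset.mul_sum, Finset.mul_sum, ← Finset.sum_sub_distrib, ← Finset.sum_add_distrib,
      ← Finset.sum_sub_distrib]
    refine Finset.sum_congr rfl fun k _ => ?_
    by_cases hk : k = 0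
    · rw [hk, hG0]; simp
    · have hzk := hz k hk
      have e3 : ZMod.stdAddChar (k * ((n + 3 : ℤ) : ZMod N)) = ZMod.stdAddChar (k * (n : ZMod N)) * z k ^ 3 := by
        simp only [z]
        rw [← AddChar.map_nsmul_eq_pow, ← AddChar.map_add_eq_mul]
        congr 1; push_cast; simp; ring
      have e2 : ZMod.stdAddChar (k * ((n + 2 : ℤ) : ZMod N)) = ZMod.stdAddChar (k * (n : ZMod N)) * z k ^ 2 := by
        simp only [z]
        rw [← AddChar.map_nsmul_eq_pow, ← AddChar.map_add_eq_mul]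
        congr 1; push_cast; simp; ring
      have e1 : ZMod.stdAddChar (k * ((n + 1 : ℤ) : ZMod N)) = ZMod.stdAddChar (k * (n : ZMod N)) * z k := by
        simp only [z]
        rw [← AddChar.map_add_eq_mul]
        congr 1; push_cast; ring
      rw [e3, e2, e1]
      field_simp
      ring
  · intro n
    simp only [T]
    rw [norm_mul, norm_inv, Complex.norm_natCast]
    have hterm : ∀ k : ZMod N, ‖ZMod.stdAddChar (k * (n : ZMod N)) * G k / (z k - 1) ^ 3‖
        ≤ c * N ^ 3 * |1 / (k.valMinAbs : ℝ) ^ 3| := by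
      intro k
      by_cases hk : k = 0
      · rw [hk, hG0]; simp
      · have hv : 0 < |(k.valMinAbs : ℝ)| := by
          rw [abs_pos]
          exact_mod_cast fun h => hk ((ZMod.valMinAbs_eq_zero k).1 h)
        have h1 := norm_std_sub_one k
        have h2 : |(k.valMinAbs : ℝ)| / N ≤ ‖z k - 1‖ := by
          refine le_trans ?_ h1
          gcongr
          linarith
        have h3 : 0 < |(k.valMinAbs : ℝ)| / N := div_pos hv hN
        rw [norm_div, norm_mul, norm_pow, ZMod.stdAddChar_apply, Circle.norm_coe, one_mul]
        calc ‖G k‖ / ‖z k - 1‖ ^ 3 ≤ c / (|(k.valMinAbs : ℝ)| / N) ^ 3 := by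
              gcongr
              exact hGc k
          _ = _ := by
              rw [abs_div, abs_pow, abs_one]
              field_simp
    have hsum : ∑ k : ZMod N, |1 / (k.valMinAbs : ℝ) ^ 3| ≤ kzeta := by
      have := kzeta_summable.sum_le_tsum (Finset.univ.image (ZMod.valMinAbs : ZMod N → ℤ))
        (fun _ _ => abs_nonneg _)
      rwa [Finset.sum_image (fun a _ b _ h => ZMod.injective_valMinAbs h)] at this
    calc (N : ℝ)⁻¹ * ‖∑ k, ZMod.stdAddChar (k * (n : ZMod N)) * G k / (z k - 1) ^ 3‖
        ≤ (N : ℝ)⁻¹ * ∑ k : ZMod N, c * N ^ 3 * |1 / (k.valMinAbs : ℝ) ^ 3| := by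
          gcongr
          exact (norm_sum_le _ _).trans (Finset.sum_le_sum fun k _ => hterm k)
      _ = (c * N ^ 2) * ∑ k : ZMod N, |1 / (k.valMinAbs : ℝ) ^ 3| := by
          rw [← Finset.mul_sum]; field_simp
      _ ≤ (c * N ^ 2) * kzeta := by gcongr
      _ = _ := by ring

theorem quad_abs_le (p : ℕ) [Fact p.Prime] (x : ZMod p) :
    ‖((quadraticChar (ZMod p) x : ℤ) : ℂ)‖ ≤ 1 := by
  rcases quadraticChar_isQuadratic (ZMod p) x with h | h | h <;> rw [h] <;> simp

theorem local_bound (p : ℕ) [Fact p.Prime] (hp2 : p ≠ 2) (e : ℕ) (he : 1 ≤ e)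
    (ψ : AddChar (ZMod p) ℂ) :
    ‖∑ x : ZMod p, ((quadraticChar (ZMod p) x : ℤ) : ℂ) ^ e * ψ x‖ * (p : ℝ) ^ 2
      ≤ (Real.sqrt p ^ 5) ^ e := by
  have hs : Real.sqrt p ^ 2 = p := Real.sq_sqrt (by positivity)
  have hs1 : 1 ≤ Real.sqrt p := by
    rw [Real.one_le_sqrt]; exact_mod_cast (Fact.out : p.Prime).one_lt.le
  rcases Nat.lt_or_ge e 2 with h | h
  · have : e = 1 := by omega
    subst this
    simp only [pow_one]
    have h1 := gauss_bound p hp2 ψ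
    calc _ ≤ Real.sqrt p * (p : ℝ) ^ 2 := by gcongr
      _ = _ := by rw [← hs]; rw [hs]; nth_rewrite 2 [← hs]; ring
  · have h1 : ‖∑ x : ZMod p, ((quadraticChar (ZMod p) x : ℤ) : ℂ) ^ e * ψ x‖ ≤ p := by
      refine (norm_sum_le _ _).trans ?_
      calc _ ≤ ∑ x : ZMod p, (1 : ℝ) := Finset.sum_le_sum fun x _ => by
            rw [norm_mul, norm_pow, AddChar.norm_apply, mul_one]
            exact pow_le_one₀ (norm_nonneg _) (quad_abs_le p x)
        _ = p := by simp
    calc _ ≤ (p : ℝ) * (p : ℝ) ^ 2 := by gcongr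
      _ = Real.sqrt p ^ 6 := by nth_rewrite 1 2 [← hs]; ring
      _ ≤ Real.sqrt p ^ (5 * e) := pow_le_pow_right₀ hs1 (by omega)
      _ = _ := by rw [pow_mul]

theorem char_antideriv (r : ℕ) (hr : Odd r) (t : Fin r → ℕ) (ht : ∀ j, (t j).Prime ∧ t j ≠ 2) :
    ∃ T : ℤ → ℝ, (∀ n : ℤ, T (n + 3) - 3 * T (n + 2) + 3 * T (n + 1) - T n
        = ∏ j, (jacobiSym n (t j) : ℝ)) ∧
      ∀ n, |T n| ≤ kzeta * ∏ j, Real.sqrt (t j) ^ 5 := by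
  classical
  let s := Finset.univ.image t
  let a : s → ℕ := fun i => i.1
  have hpr : ∀ i : s, (a i).Prime ∧ a i ≠ 2 := by
    rintro ⟨q, hq⟩
    obtain ⟨j, _, rfl⟩ := Finset.mem_image.1 hq
    exact ht j
  have hF : ∀ i, Fact (a i).Prime := fun i => ⟨(hpr i).1⟩
  have hNZ : ∀ i, NeZero (a i) := fun i => ⟨(hpr i).1.ne_zero⟩
  have hN : NeZero (∏ i, a i) := ⟨Finset.prod_ne_zero_iff.2 fun i _ => (hpr i).1.ne_zero⟩
  have hco : Pairwise (Function.onFun Nat.Coprime a) := by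
    intro i j hij
    exact (Nat.coprime_primes (hpr i).1 (hpr j).1).2 fun h => hij (Subtype.ext h)
  let e : s → ℕ := fun i => (Finset.univ.filter (fun j => t j = i.1)).card
  have he1 : ∀ i, 1 ≤ e i := by
    rintro ⟨q, hq⟩
    obtain ⟨j, _, rfl⟩ := Finset.mem_image.1 hq
    exact Finset.card_pos.2 ⟨j, by simp⟩
  have hcomp : ∀ {M : Type} [CommMonoid M] (g : ℕ → M), ∏ j, g (t j) = ∏ i : s, g (a i) ^ e i := by
    intro M _ g
    rw [Finset.prod_comp g t]
    exact (Finset.prod_coe_sort s (fun b => g b ^ (Finset.univ.filter (fun j => t j = b)).card)).symm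
  have hesum : ∑ i, e i = r := by
    have h := Finset.card_eq_sum_card_image t Finset.univ
    rw [Finset.card_univ, Fintype.card_fin] at h
    rw [h]
    exact Finset.sum_coe_sort s (fun b => (Finset.univ.filter (fun j => t j = b)).card)
  obtain ⟨i0, hi0⟩ : ∃ i, Odd (e i) := by
    by_contra! h
    have : Even (∑ i, e i) := Finset.even_sum _ fun i _ => Nat.not_odd_iff_even.1 (h i)
    rw [hesum] at this
    exact (Nat.not_odd_iff_even.2 this) hr
  let h : ∀ i, ZMod (a i) → ℂ := fun i y => ((quadraticChar (ZMod (a i)) y : ℤ) : ℂ) ^ e i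
  let Φ : ZMod (∏ i, a i) → ℂ := fun x => ∏ i, h i (ZMod.prodEquivPi a hco x i)
  have hmean : ∑ x, Φ x = 0 := by
    obtain ⟨φ, hφ1, hφ⟩ := crt_sum a hco h 1
    simp only [AddChar.one_apply, mul_one] at hφ
    change ∑ x, ∏ i, h i (ZMod.prodEquivPi a hco x i) = 0
    rw [hφ]
    apply Finset.prod_eq_zero (Finset.mem_univ i0)
    rw [hφ1 rfl i0]
    simp only [AddChar.one_apply, mul_one, h]
    have hRC : ringChar (ZMod (a i0)) ≠ 2 := by rw [ZMod.ringChar_zmod_n]; exact (hpr i0).2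
    have hq := quadraticChar_sum_zero hRC
    have : ∀ y : ZMod (a i0), ((quadraticChar (ZMod (a i0)) y : ℤ) : ℂ) ^ e i0
        = ((quadraticChar (ZMod (a i0)) y : ℤ) : ℂ) := by
      intro y
      rcases quadraticChar_isQuadratic (ZMod (a i0)) y with h | h | h <;> rw [h]
      · have := he1 i0
        simp; omega
      · simp
      · simp [hi0.neg_one_pow]
    rw [Finset.sum_congr rfl fun y _ => this y]
    exact_mod_cast hq
  have hpos : (0 : ℝ) < ((∏ i, a i : ℕ) : ℝ) := by
    exact_mod_cast Nat.pos_of_ne_zero hN.ne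
  have hbd : ∀ ψ : AddChar (ZMod (∏ i, a i)) ℂ, ‖∑ x, Φ x * ψ x‖
      ≤ (∏ j, Real.sqrt (t j) ^ 5) / ((∏ i, a i : ℕ) : ℝ) ^ 2 := by
    intro ψ
    obtain ⟨φ, _, hφ⟩ := crt_sum a hco h ψ
    rw [le_div_iff₀ (by positivity)]
    change ‖∑ x, (∏ i, h i (ZMod.prodEquivPi a hco x i)) * ψ x‖ * _ ≤ _
    rw [hφ, norm_prod, hcomp (fun q => Real.sqrt q ^ 5)]
    push_cast
    rw [← Finset.prod_pow, ← Finset.prod_mul_distrib]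
    refine Finset.prod_le_prod (fun i _ => by positivity) fun i _ => ?_
    exact local_bound (a i) (hpr i).2 (e i) (he1 i) (φ i)
  obtain ⟨T, hT1, hT2⟩ := third_antideriv Φ _ hmean hbd
  refine ⟨fun n => (T n).re, ?_, ?_⟩
  · intro n
    have h1 := hT1 n
    have h2 : Φ n = ((∏ j, (jacobiSym n (t j) : ℝ) : ℝ) : ℂ) := by
      rw [hcomp (fun q => (jacobiSym n q : ℝ))]
      simp only [Φ, h]
      push_cast
      refine Finset.prod_congr rfl fun i _ => ?_
      congr 1
      rw [← jacobiSym.legendreSym.to_jacobiSym, legendreSym]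
      have hcast : ZMod.prodEquivPi a hco (n : ZMod (∏ i, a i)) i = (n : ZMod (a i)) := by
        rw [map_intCast]; rfl
      rw [hcast]
    rw [h2] at h1
    have h3 := congrArg Complex.re h1
    rw [Complex.ofReal_re] at h3
    rw [← h3]
    simp [Complex.mul_re]
  · intro n
    refine (Complex.abs_re_le_norm _).trans ((hT2 n).trans (le_of_eq ?_))
    congr 1
    field_simp

theorem diff_bound (G G' : ℝ → ℝ) (hG : ∀ s, HasDerivAt G (G' s) s) (M δ : ℝ) (hδ : 0 ≤ δ)
    (hM : ∀ s, |G' s| ≤ M) (s : ℝ) : |G s - G (s - δ)| ≤ M * δ := by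
  have := convex_univ.norm_image_sub_le_of_norm_hasDerivWithin_le (f := G) (f' := G') (C := M)
    (fun x _ => (hG x).hasDerivWithinAt) (fun x _ => hM x) (Set.mem_univ (s - δ)) (Set.mem_univ s)
  rw [Real.norm_eq_abs, Real.norm_eq_abs] at this
  simpa [abs_of_nonneg hδ] using this

theorem third_diff_bound (H : ℝ → ℝ) (hH : ContDiff ℝ 3 H) (M : ℝ)
    (hM : ∀ s, |deriv (deriv (deriv H)) s| ≤ M) (δ : ℝ) (hδ : 0 ≤ δ) (s : ℝ) :
    |H (s - 3 * δ) - 3 * H (s - 2 * δ) + 3 * H (s - δ) - H s| ≤ M * δ ^ 3 := by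
  have h1 : ContDiff ℝ 2 (deriv H) := by
    have : ContDiff ℝ (2 + 1) H := by norm_num; exact hH
    exact (contDiff_succ_iff_deriv.1 this).2.2
  have h2 : ContDiff ℝ 1 (deriv (deriv H)) := by
    have : ContDiff ℝ (1 + 1) (deriv H) := by norm_num; exact h1
    exact (contDiff_succ_iff_deriv.1 this).2.2
  have d0 : ∀ s, HasDerivAt H (deriv H s) s := fun s =>
    ((hH.differentiable (by norm_num)) s).hasDerivAt
  have d1 : ∀ s, HasDerivAt (deriv H) (deriv (deriv H) s) s := fun s =>
    ((h1.differentiable (by norm_num)) s).hasDerivAt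
  have d2 : ∀ s, HasDerivAt (deriv (deriv H)) (deriv (deriv (deriv H)) s) s := fun s =>
    ((h2.differentiable (by norm_num)) s).hasDerivAt
  have sh : ∀ (G G' : ℝ → ℝ), (∀ s, HasDerivAt G (G' s) s) →
      ∀ s, HasDerivAt (fun s => G s - G (s - δ)) (G' s - G' (s - δ)) s := by
    intro G G' hG s
    refine (hG s).sub ?_
    exact (hG (s - δ)).comp_sub_const s δ
  have b2 := diff_bound _ _ d2 M δ hδ hM
  have b1 := diff_bound _ _ (sh _ _ d1) (M * δ) δ hδ b2
  have b0 := diff_bound _ _ (sh _ _ (sh _ _ d0)) (M * δ * δ) δ hδ b1 s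
  rw [abs_sub_comm] at b0
  have e3 : s - δ - δ - δ = s - 3 * δ := by ring
  have e2 : s - δ - δ = s - 2 * δ := by ring
  rw [e3, e2] at b0
  rw [← abs_neg] at b0 ⊢
  convert b0 using 1
  · congr 1; ring
  · ring

theorem smooth_sum_bound (H : ℝ → ℝ) (hH : ContDiff ℝ 3 H)
    (hsupp : Function.support H ⊆ Set.Ioo (1 / 2 : ℝ) 1) :
    ∃ C : ℝ, 0 ≤ C ∧ ∀ X : ℝ, 1 ≤ X → ∀ (T χ : ℤ → ℝ) (b : ℝ),
      (∀ n, T (n + 3) - 3 * T (n + 2) + 3 * T (n + 1) - T n = χ n) → (∀ n, |T n| ≤ b) →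
      |∑' D : ℤ, χ D * H (D / X)| ≤ C * b / X ^ 2 := by
  have hcs : HasCompactSupport H := by
    refine HasCompactSupport.of_support_subset_isCompact (isCompact_Icc (a := (1/2 : ℝ)) (b := 1)) ?_
    exact hsupp.trans Set.Ioo_subset_Icc_self
  have hc3 : Continuous (deriv (deriv (deriv H))) := by
    have h1 : ContDiff ℝ 2 (deriv H) := by
      have : ContDiff ℝ (2 + 1) H := by norm_num; exact hH
      exact (contDiff_succ_iff_deriv.1 this).2.2
    have h2 : ContDiff ℝ 1 (deriv (deriv H)) := by
      have : ContDiff ℝ (1 + 1) (deriv H) := by norm_num; exact h1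
      exact (contDiff_succ_iff_deriv.1 this).2.2
    exact h2.continuous_deriv le_rfl
  obtain ⟨M, hM⟩ := (hcs.deriv.deriv.deriv).exists_bound_of_continuous hc3
  have hM0 : 0 ≤ M := (norm_nonneg _).trans (hM 0)
  refine ⟨5 * M, by positivity, ?_⟩
  intro X hX T χ b hT hb
  have hX0 : 0 < X := by linarith
  have hb0 : 0 ≤ b := (abs_nonneg _).trans (hb 0)
  let h : ℤ → ℝ := fun n => H (n / X)
  have hz : ∀ n : ℤ, n ∉ Finset.Icc (0 : ℤ) ⌊X⌋ → h n = 0 := by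
    intro n hn
    by_contra hne
    have := hsupp hne
    apply hn
    rw [Finset.mem_Icc]
    have h1 : 0 < (n : ℝ) / X := by linarith [this.1]
    have h2 : (n : ℝ) < X := by
      have := this.2
      rwa [div_lt_one hX0] at this
    constructor
    · have : 0 < (n : ℝ) := by
        have := (div_pos_iff_of_pos_right hX0).1 h1
        exact this
      exact_mod_cast this.le
    · exact Int.le_floor.2 h2.le
  have hsum : ∀ (m : ℤ) (a : ℝ), Summable fun n : ℤ => a * T (n + m) * h n := by
    intro m a
    apply summable_of_ne_finset_zero (s := Finset.Icc (0 : ℤ) ⌊X⌋)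
    intro n hn
    rw [hz n hn, mul_zero]
  have hshift : ∀ (m : ℤ) (a : ℝ), HasSum (fun n : ℤ => a * T n * h (n - m))
      (∑' n : ℤ, a * T (n + m) * h n) := by
    intro m a
    have := (hsum m a).hasSum
    rw [← (Equiv.subRight m).hasSum_iff] at this
    convert this using 1
    funext n
    simp
  have hs := (((hshift 3 1).add (hshift 2 (-3))).add (hshift 1 3)).add (hshift 0 (-1))
  have e1 : (∑' n : ℤ, 1 * T (n + 3) * h n) + (∑' n : ℤ, (-3) * T (n + 2) * h n)
      + (∑' n : ℤ, 3 * T (n + 1) * h n) + (∑' n : ℤ, (-1) * T (n + 0) * h n)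
      = ∑' n : ℤ, χ n * h n := by
    rw [← (hsum 3 1).tsum_add (hsum 2 (-3)), ← ((hsum 3 1).add (hsum 2 (-3))).tsum_add (hsum 1 3),
      ← (((hsum 3 1).add (hsum 2 (-3))).add (hsum 1 3)).tsum_add (hsum 0 (-1))]
    refine tsum_congr fun n => ?_
    rw [← hT, add_zero]; ring
  rw [e1] at hs
  change |∑' n : ℤ, χ n * h n| ≤ _
  rw [← hs.tsum_eq]
  have hterm : ∀ n : ℤ, |1 * T n * h (n - 3) + (-3) * T n * h (n - 2) + 3 * T n * h (n - 1)
      + (-1) * T n * h (n - 0)| ≤ b * (M * (1 / X) ^ 3) := by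
    intro n
    have h1 := third_diff_bound H hH M hM (1 / X) (by positivity) (n / X)
    have e : 1 * T n * h (n - 3) + (-3) * T n * h (n - 2) + 3 * T n * h (n - 1)
      + (-1) * T n * h (n - 0) = T n * (H (n / X - 3 * (1 / X)) - 3 * H (n / X - 2 * (1 / X))
        + 3 * H (n / X - 1 / X) - H (n / X)) := by
      simp only [h]
      push_cast
      have e3 : ((n : ℝ) - 3) / X = n / X - 3 * (1 / X) := by ring
      have e2 : ((n : ℝ) - 2) / X = n / X - 2 * (1 / X) := by ring
      have e1 : ((n : ℝ) - 1) / X = n / X - 1 / X := by ring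
      rw [e3, e2, e1, sub_zero]; ring
    rw [e, abs_mul]
    exact mul_le_mul (hb n) h1 (abs_nonneg _) hb0
  rw [tsum_eq_sum (s := Finset.Icc (0 : ℤ) (⌊X⌋ + 3))]
  · refine (Finset.abs_sum_le_sum_abs _ _).trans ?_
    refine (Finset.sum_le_sum fun n _ => hterm n).trans ?_
    rw [Finset.sum_const, Int.card_Icc, nsmul_eq_mul]
    have hf : ((⌊X⌋ + 3 + 1 - 0).toNat : ℝ) ≤ 5 * X := by
      have h0 : 0 ≤ ⌊X⌋ := Int.floor_nonneg.2 hX0.le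
      have h1 : (((⌊X⌋ + 3 + 1 - 0).toNat : ℤ) : ℝ) = ((⌊X⌋ + 3 + 1 - 0 : ℤ) : ℝ) := by
        rw [Int.toNat_of_nonneg (by omega)]
      have h2 : ((⌊X⌋ + 3 + 1 - 0).toNat : ℝ) = (((⌊X⌋ + 3 + 1 - 0).toNat : ℤ) : ℝ) :=
        (Int.cast_natCast _).symm
      rw [h2, h1]
      push_cast
      have := Int.floor_le X
      linarith
    calc _ ≤ 5 * X * (b * (M * (1 / X) ^ 3)) := by gcongr
      _ = _ := by field_simp
  · intro n hn
    rw [Finset.mem_Icc] at hn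
    have hh : ∀ m : ℤ, 0 ≤ m → m ≤ 3 → h (n - m) = 0 := by
      intro m h0 h3
      apply hz
      rw [Finset.mem_Icc]
      omega
    rw [hh 3 (by norm_num) (by norm_num), hh 2 (by norm_num) (by norm_num),
      hh 1 (by norm_num) (by norm_num), hh 0 (by norm_num) (by norm_num)]
    ring

theorem logpow_support (W : ℝ → ℝ) (hW_supp : Function.support W ⊆ Set.Ioo (1 / 2 : ℝ) 1) (j : ℕ) :
    Function.support (fun s => (2 * Real.log s) ^ j * W s) ⊆ Set.Ioo (1 / 2 : ℝ) 1 := by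
  intro s hs
  apply hW_supp
  intro h
  apply hs
  simp [h]

theorem logpow_smooth (W : ℝ → ℝ) (hW_smooth : ContDiff ℝ 3 W)
    (hW_supp : Function.support W ⊆ Set.Ioo (1 / 2 : ℝ) 1) (j : ℕ) :
    ContDiff ℝ 3 (fun s => (2 * Real.log s) ^ j * W s) := by
  rw [contDiff_iff_contDiffAt]
  intro s
  rcases lt_or_ge s (1 / 2) with h | h
  · have : (fun s => (2 * Real.log s) ^ j * W s) =ᶠ[nhds s] fun _ => 0 := by
      filter_upwards [Iio_mem_nhds h] with y hy
      by_contra hne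
      have := logpow_support W hW_supp j hne
      exact absurd this.1 (not_lt.2 (le_of_lt hy))
    exact contDiffAt_const.congr_of_eventuallyEq this
  · have hs : s ≠ 0 := by intro h0; rw [h0] at h; norm_num at h
    exact ((contDiffAt_const.mul (Real.contDiffAt_log.2 hs)).pow j).mul hW_smooth.contDiffAt

open Classical in
/-- The finite set of primes occurring in `REC`. -/
noncomputable def primesEC (A B : ℤ) (x : ℝ) : Finset ℕ :=
  (Finset.Icc 1 ⌊x⌋₊).filter
    (fun p => p.Prime ∧ Odd p ∧ ¬ ((p : ℤ) ∣ 6 * (4 * A ^ 3 + 27 * B ^ 2)))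

theorem REC_eq (A B : ℤ) (x : ℝ) (hx : 0 < Real.log x) (hx0 : 0 < x) (D : ℤ) :
    REC A B x D = ∑ p ∈ primesEC A B x, (2 * betaEC A B x p) * (jacobiSym D p : ℝ) := by
  classical
  unfold REC primesEC
  rw [tsum_eq_sum (s := Finset.Icc 1 ⌊x⌋₊), Finset.sum_filter, Finset.mul_sum]
  · refine Finset.sum_congr rfl fun p _ => ?_
    split_ifs <;> ring
  · intro p hp
    split_ifs with h
    · have h1 : x < p := by
        rw [Finset.mem_Icc] at hp
        have h2 := h.1.one_lt
        have : ⌊x⌋₊ < p := by omega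
        exact (Nat.floor_lt hx0.le).1 this
      have h3 : Real.log x ≤ Real.log p := Real.log_le_log hx0 h1.le
      have h4 : 1 ≤ Real.log p / Real.log x := by rwa [one_le_div hx]
      have : betaEC A B x p = 0 := by
        unfold betaEC
        rw [max_eq_left, mul_zero]
        rw [abs_of_pos (by linarith)]; linarith
      rw [this, zero_mul]
    · rfl

theorem beta_bound (A B : ℤ) (x : ℝ) (p : ℕ) (hp : p ∈ primesEC A B x) :
    |betaEC A B x p| * Real.sqrt p ^ 5 ≤ 23 * x ^ 2 * Real.log x := by
  classical
  unfold primesEC at hp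
  rw [Finset.mem_filter, Finset.mem_Icc] at hp
  obtain ⟨⟨hp1, hpx⟩, hpp, hodd, -⟩ := hp
  have hp2 : p ≠ 2 := by rintro rfl; exact absurd hodd (by decide)
  have hpR : (1 : ℝ) ≤ p := by exact_mod_cast hp1
  have hxp : (p : ℝ) ≤ x := (Nat.le_floor_iff' (by omega)).1 hpx
  have hlog : 0 ≤ Real.log p := Real.log_nonneg hpR
  have hlogx : Real.log p ≤ Real.log x := Real.log_le_log (by linarith) hxp
  have hs : Real.sqrt p ^ 2 = p := Real.sq_sqrt (by positivity)
  have hha := hasse_weak A B p hpp hp2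
  have hm : |max 0 (1 - |Real.log p / Real.log x|)| ≤ 1 := by
    rw [abs_of_nonneg (le_max_left _ _)]
    exact max_le (by norm_num) (by linarith [abs_nonneg (Real.log p / Real.log x)])
  unfold betaEC
  rw [abs_mul, abs_div, abs_mul, abs_of_nonneg hlog, abs_of_nonneg (by linarith : (0:ℝ) ≤ p)]
  calc _ ≤ 23 * Real.sqrt p * Real.log p / p * 1 * Real.sqrt p ^ 5 := by gcongr
    _ = 23 * Real.log p / p * (Real.sqrt p ^ 2) ^ 3 := by ring
    _ = 23 * (p : ℝ) ^ 2 * Real.log p := by rw [hs]; field_simp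
    _ ≤ 23 * x ^ 2 * Real.log x := by gcongr

theorem inner_bound (A B : ℤ) (r : ℕ) (hr : Odd r) (H : ℝ → ℝ)
    (hsupp : Function.support H ⊆ Set.Ioo (1 / 2 : ℝ) 1) (C : ℝ) (hC0 : 0 ≤ C)
    (hC : ∀ X : ℝ, 1 ≤ X → ∀ (T χ : ℤ → ℝ) (b : ℝ),
      (∀ n, T (n + 3) - 3 * T (n + 2) + 3 * T (n + 1) - T n = χ n) → (∀ n, |T n| ≤ b) →
      |∑' D : ℤ, χ D * H (D / X)| ≤ C * b / X ^ 2)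
    (x : ℝ) (hx : 0 < Real.log x) (hx0 : 0 < x) (X : ℝ) (hX : 1 ≤ X) :
    |∑' D : ℤ, REC A B x D ^ r * H (D / X)|
      ≤ C * kzeta * (46 * x ^ 3 * Real.log x) ^ r / X ^ 2 := by
  classical
  have hX0 : 0 < X := by linarith
  set P := primesEC A B x with hP
  have hPp : ∀ p ∈ P, p.Prime ∧ p ≠ 2 := by
    intro p hp
    rw [hP, primesEC, Finset.mem_filter] at hp
    refine ⟨hp.2.1, ?_⟩
    rintro rfl; exact absurd hp.2.2.1 (by decide)
  have hexp : ∀ D : ℤ, REC A B x D ^ r * H (D / X)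
      = ∑ t ∈ Fintype.piFinset (fun _ : Fin r => P),
        (∏ j, 2 * betaEC A B x (t j)) * ((∏ j, (jacobiSym D (t j) : ℝ)) * H (D / X)) := by
    intro D
    rw [REC_eq A B x hx hx0, Finset.sum_pow', Finset.sum_mul]
    refine Finset.sum_congr rfl fun t _ => ?_
    rw [Finset.prod_mul_distrib]; ring
  have hfs : ∀ g : ℤ → ℝ, Summable fun D : ℤ => g D * H (D / X) := by
    intro g
    apply summable_of_ne_finset_zero (s := Finset.Icc (0 : ℤ) ⌊X⌋)
    intro n hn
    by_contra hne
    have hne' : H (n / X) ≠ 0 := fun h => hne (by rw [h, mul_zero])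
    have := hsupp hne'
    apply hn
    rw [Finset.mem_Icc]
    have h1 : 0 < (n : ℝ) / X := by linarith [this.1]
    have h2 : (n : ℝ) < X := by
      have := this.2
      rwa [div_lt_one hX0] at this
    have h3 := (div_pos_iff_of_pos_right hX0).1 h1
    exact ⟨by exact_mod_cast h3.le, Int.le_floor.2 h2.le⟩
  simp_rw [hexp]
  rw [Summable.tsum_finsetSum (fun t _ => (hfs _).mul_left _)]
  refine (Finset.abs_sum_le_sum_abs _ _).trans ?_
  have hterm : ∀ t ∈ Fintype.piFinset (fun _ : Fin r => P),
      |∑' D : ℤ, (∏ j, 2 * betaEC A B x (t j)) * ((∏ j, (jacobiSym D (t j) : ℝ)) * H (D / X))|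
      ≤ C * kzeta / X ^ 2 * ∏ j, (|2 * betaEC A B x (t j)| * Real.sqrt (t j) ^ 5) := by
    intro t ht
    rw [Fintype.mem_piFinset] at ht
    rw [tsum_mul_left, abs_mul, Finset.abs_prod]
    obtain ⟨T, hT1, hT2⟩ := char_antideriv r hr t (fun j => hPp _ (ht j))
    have h1 := hC X hX T _ _ hT1 hT2
    rw [Finset.prod_mul_distrib]
    calc _ ≤ (∏ j, |2 * betaEC A B x (t j)|) * (C * (kzeta * ∏ j, Real.sqrt (t j) ^ 5) / X ^ 2) :=
          mul_le_mul_of_nonneg_left h1 (Finset.prod_nonneg fun _ _ => abs_nonneg _)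
      _ = _ := by ring
  refine (Finset.sum_le_sum hterm).trans ?_
  rw [← Finset.mul_sum]
  rw [← Finset.sum_pow' P (fun p => |2 * betaEC A B x p| * Real.sqrt p ^ 5) r]
  have hsum : ∑ p ∈ P, |2 * betaEC A B x p| * Real.sqrt p ^ 5 ≤ 46 * x ^ 3 * Real.log x := by
    have hcard : (P.card : ℝ) ≤ x := by
      have : P.card ≤ ⌊x⌋₊ := by
        refine (Finset.card_filter_le _ _).trans ?_
        simp
      exact (Nat.cast_le.2 this).trans (Nat.floor_le hx0.le)
    calc _ ≤ ∑ p ∈ P, 46 * x ^ 2 * Real.log x := Finset.sum_le_sum fun p hp => by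
          have := beta_bound A B x p hp
          rw [abs_mul, abs_two]; linarith
      _ = P.card * (46 * x ^ 2 * Real.log x) := by rw [Finset.sum_const, nsmul_eq_mul]
      _ ≤ x * (46 * x ^ 2 * Real.log x) := by gcongr
      _ = _ := by ring
  have hk := kzeta_nonneg
  have hnn : 0 ≤ ∑ p ∈ P, |2 * betaEC A B x p| * Real.sqrt p ^ 5 :=
    Finset.sum_nonneg fun p _ => by positivity
  calc _ ≤ C * kzeta / X ^ 2 * (46 * x ^ 3 * Real.log x) ^ r := by gcongr
    _ = _ := by ring

end Helpers

/-- For `f(x,D) = 2 log|D| + (log x)/2`, odd `r ≥ 1`, and `W`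
nonnegative, thrice continuously differentiable, compactly supported on `(1/2,1)`:
`|∑_{D ≠ 0} f(x,D)^i R(x,D)^r W(D/X_k)| ≤ C x^{3r} (log x)^{r+i} / X_k²`
for all `x ≥ x₀`. -/
theorem stmt_9 (A B : ℤ) (hΔ : 4 * A ^ 3 + 27 * B ^ 2 ≠ 0)
    (W : ℝ → ℝ) (hW_nonneg : ∀ t, 0 ≤ W t)
    (hW_smooth : ContDiff ℝ 3 W)
    (hW_supp : Function.support W ⊆ Set.Ioo (1 / 2 : ℝ) 1)
    (k i r : ℕ) (hk : 1 ≤ k) (hr : 1 ≤ r) (hrodd : Odd r) :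
    ∃ C > (0 : ℝ), ∃ x₀ : ℝ, ∀ x : ℝ, x₀ ≤ x →
      |∑' D : {D : ℤ // D ≠ 0},
          (2 * Real.log |((D : ℤ) : ℝ)| + Real.log x / 2) ^ i *
            REC A B x (D : ℤ) ^ r * W (((D : ℤ) : ℝ) / XkEC x k)|
        ≤ C * x ^ (3 * r) * Real.log x ^ (r + i) / XkEC x k ^ 2 := by
  let H : ℕ → ℝ → ℝ := fun j s => (2 * Real.log s) ^ j * W s
  have hHs : ∀ j, Function.support (H j) ⊆ Set.Ioo (1 / 2 : ℝ) 1 := logpow_support W hW_supp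
  have hHc : ∀ j, ContDiff ℝ 3 (H j) := logpow_smooth W hW_smooth hW_supp
  choose Cs hCs0 hCs using fun j => smooth_sum_bound (H j) (hHc j) (hHs j)
  have hkz := kzeta_nonneg
  set K : ℝ := 5 * k + 5 with hK
  have hK1 : 1 ≤ K := by rw [hK]; have : (0:ℝ) ≤ k := Nat.cast_nonneg _; linarith
  set S : ℝ := ∑ j ∈ Finset.range (i + 1), (i.choose j : ℝ) * K ^ i * (Cs j * kzeta * 46 ^ r) with hS
  have hS0 : 0 ≤ S := Finset.sum_nonneg fun j _ => by
    have := hCs0 j; positivity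
  refine ⟨S + 1, by linarith, Real.exp 1, ?_⟩
  intro x hx
  have hx0 : 0 < x := (Real.exp_pos 1).trans_le hx
  have hL : 1 ≤ Real.log x := (Real.le_log_iff_exp_le hx0).2 hx
  have hL0 : 0 < Real.log x := by linarith
  have hx1 : 1 ≤ x := by
    have := Real.add_one_le_exp (1 : ℝ); linarith
  set X := XkEC x k with hXdef
  have hX : 1 ≤ X := by
    rw [hXdef, XkEC]
    exact one_le_mul_of_one_le_of_one_le (Real.one_le_rpow hx1 (by positivity)) (one_le_pow₀ hL)
  have hX0 : 0 < X := by linarith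
  have hlogX : Real.log X = k / 2 * Real.log x + (2 * k + 2) * Real.log (Real.log x) := by
    rw [hXdef, XkEC, Real.log_mul (by positivity) (by positivity), Real.log_rpow hx0, Real.log_pow]
    push_cast; ring
  set L := Real.log x with hLdef
  set c := 2 * Real.log X + L / 2 with hc
  have hc0 : 0 ≤ c := by
    have := Real.log_nonneg hX; rw [hc]; linarith
  have hcK : c ≤ K * L := by
    have h1 : Real.log L ≤ L := by
      have := Real.log_le_sub_one_of_pos hL0; linarith
    have hk0 : (0 : ℝ) ≤ k := Nat.cast_nonneg _
    have h2 : (2 * (k : ℝ) + 2) * Real.log L ≤ (2 * k + 2) * L := by gcongr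
    rw [hc, hlogX, hK]
    nlinarith
  -- rewrite the sum
  have hexp : ∀ D : ℤ, (2 * Real.log |(D : ℝ)| + L / 2) ^ i * REC A B x D ^ r * W ((D : ℝ) / X)
      = ∑ j ∈ Finset.range (i + 1), (i.choose j : ℝ) * c ^ (i - j) *
          (REC A B x D ^ r * H j ((D : ℝ) / X)) := by
    intro D
    by_cases hW0 : W ((D : ℝ) / X) = 0
    · simp [H, hW0]
    · have hmem := hW_supp hW0
      have hpos : 0 < (D : ℝ) / X := by linarith [hmem.1]
      have hD : 0 < (D : ℝ) := (div_pos_iff_of_pos_right hX0).1 hpos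
      have e : 2 * Real.log |(D : ℝ)| + L / 2 = 2 * Real.log ((D : ℝ) / X) + c := by
        rw [abs_of_pos hD, Real.log_div hD.ne' hX0.ne', hc]; ring
      rw [e, add_pow, Finset.sum_mul, Finset.sum_mul]
      refine Finset.sum_congr rfl fun j _ => ?_
      simp only [H]; ring
  have hsub : ∑' D : {D : ℤ // D ≠ 0}, (2 * Real.log |((D : ℤ) : ℝ)| + L / 2) ^ i *
            REC A B x (D : ℤ) ^ r * W (((D : ℤ) : ℝ) / X)
      = ∑' D : ℤ, (2 * Real.log |(D : ℝ)| + L / 2) ^ i * REC A B x D ^ r * W ((D : ℝ) / X) := by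
    refine tsum_subtype_eq_of_support_subset (s := {D : ℤ | D ≠ 0})
      (f := fun D : ℤ => (2 * Real.log |(D : ℝ)| + L / 2) ^ i * REC A B x D ^ r * W ((D : ℝ) / X)) ?_
    intro D hD h0
    apply hD
    have hW0 : W 0 = 0 := by
      by_contra h
      have := (hW_supp h).1
      norm_num at this
    simp [h0, hW0]
  rw [hsub]
  simp_rw [hexp]
  have hfs : ∀ (j : ℕ) (g : ℤ → ℝ), Summable fun D : ℤ => g D * H j (D / X) := by
    intro j g
    apply summable_of_ne_finset_zero (s := Finset.Icc (0 : ℤ) ⌊X⌋)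
    intro n hn
    by_contra hne
    have hne' : H j (n / X) ≠ 0 := fun h => hne (by rw [h, mul_zero])
    have := hHs j hne'
    apply hn
    rw [Finset.mem_Icc]
    have h1 : 0 < (n : ℝ) / X := by linarith [this.1]
    have h2 : (n : ℝ) < X := by
      have := this.2
      rwa [div_lt_one hX0] at this
    have h3 := (div_pos_iff_of_pos_right hX0).1 h1
    exact ⟨by exact_mod_cast h3.le, Int.le_floor.2 h2.le⟩
  rw [Summable.tsum_finsetSum (fun j _ => (hfs j _).mul_left _)]
  refine (Finset.abs_sum_le_sum_abs _ _).trans ?_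
  have hterm : ∀ j ∈ Finset.range (i + 1),
      |∑' D : ℤ, (i.choose j : ℝ) * c ^ (i - j) * (REC A B x D ^ r * H j ((D : ℝ) / X))|
      ≤ (i.choose j : ℝ) * K ^ i * (Cs j * kzeta * 46 ^ r) * (x ^ (3 * r) * L ^ (r + i) / X ^ 2) := by
    intro j _
    rw [tsum_mul_left, abs_mul]
    have h1 := inner_bound A B r hrodd (H j) (hHs j) (Cs j) (hCs0 j) (hCs j) x hL0 hx0 X hX
    have h2 : |(i.choose j : ℝ) * c ^ (i - j)| ≤ (i.choose j : ℝ) * (K ^ i * L ^ i) := by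
      rw [abs_of_nonneg (by positivity)]
      gcongr
      calc c ^ (i - j) ≤ (K * L) ^ (i - j) := by gcongr
        _ ≤ (K * L) ^ i := pow_le_pow_right₀ (one_le_mul_of_one_le_of_one_le hK1 hL) (by omega)
        _ = _ := mul_pow _ _ _
    have hCj := hCs0 j
    calc _ ≤ (i.choose j : ℝ) * (K ^ i * L ^ i) *
          (Cs j * kzeta * (46 * x ^ 3 * Real.log x) ^ r / X ^ 2) :=
          mul_le_mul h2 h1 (abs_nonneg _) (by positivity)
      _ = _ := by
          rw [← hLdef, mul_pow, mul_pow, ← pow_mul, pow_add]; ring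
  refine (Finset.sum_le_sum hterm).trans ?_
  rw [← Finset.sum_mul, ← hS]
  have hY : 0 ≤ x ^ (3 * r) * L ^ (r + i) / X ^ 2 := by positivity
  calc S * (x ^ (3 * r) * L ^ (r + i) / X ^ 2) ≤ (S + 1) * (x ^ (3 * r) * L ^ (r + i) / X ^ 2) := by
        gcongr; linarith
    _ = _ := by ring
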